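/- arXiv:2307.15485 — 6 statements merged into one kernel-verified Lean document; each statement's English description precedes it below -/
import Mathlib

section
/- Assume each R i is an equivalence relation and R satisfies the commutativity frame property. Let G ⊆ I with |G| ≥ 2, let v be a list of agents with all entries in G and length λ ≥ 2, and let ρ and τ be two lists that are permutations of v (List.Perm). Then comp(ρ) = comp(τ) as relations on W. (Semantic counterpart of Lemma 1: in C-S5_n, □_{ρ_1}…□_{ρ_λ}φ ↔ □_{τ_1}…□_{τ_λ}φ is a theorem.) -/
/-- Relational composition along a list of agents. -/
def comp {W I : Type*} (R : I → W → W → Prop) : List I → W → W → Prop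
  | [], w, v => w = v
  | i :: l, w, v => ∃ u, R i w u ∧ comp R l u v

/-- The commutativity frame property (correspondent of axiom C). -/
def CommFrame {W I : Type*} (R : I → W → W → Prop) : Prop :=
  ∀ (i j : I) (u v w : W), R j u v → R i v w → ∃ x, R i u x ∧ R j x w

/-- Under commutativity, exchanging the first two agents of a list preserves composition. -/
theorem CommFrame.comp_swap {W I : Type*} {R : I → W → W → Prop} (hC : CommFrame R)
    {i j : I} {l : List I} {w v : W} (h : comp R (i :: j :: l) w v) :
    comp R (j :: i :: l) w v := by
  obtain ⟨a, hwa, b, hab, hbv⟩ := h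
  obtain ⟨x, hwx, hxb⟩ := hC j i w a b hwa hab
  exact ⟨x, hwx, b, hxb, hbv⟩

/-- Under commutativity, composition is invariant under permutation of the list of agents. -/
theorem CommFrame.comp_eq_of_perm {W I : Type*} {R : I → W → W → Prop} (hC : CommFrame R)
    {l₁ l₂ : List I} (h : l₁.Perm l₂) : comp R l₁ = comp R l₂ := by
  induction h with
  | nil => rfl
  | cons i _ ih => simp only [comp, ih]
  | swap i j l =>
    funext w v
    exact propext ⟨hC.comp_swap, hC.comp_swap⟩
  | trans _ _ ih₁ ih₂ => exact ih₁.trans ih₂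

/-- Semantic counterpart of Lemma 1: in C-S5ₙ, permutations of a sequence of boxes
yield the same relational composition. -/
theorem comp_perm_eq {W I : Type*} (R : I → W → W → Prop)
    (hEq : ∀ i, Equivalence (R i)) (hC : CommFrame R)
    (G : Set I) (hG : 2 ≤ G.ncard)
    (v : List I) (hv : ∀ i ∈ v, i ∈ G) (hlen : 2 ≤ v.length)
    (ρ τ : List I) (hρ : ρ.Perm v) (hτ : τ.Perm v) :
    comp R ρ = comp R τ := by
  exact hC.comp_eq_of_perm (hρ.trans hτ.symm)
end

section
/- Assume each R i is an equivalence relation and R satisfies the commutativity frame property. Let L = [i_1, …, i_m] be a duplicate-free list of agents with m ≥ 2, and let l be any list of agents all of whose entries occur in L. Then comp(l) ⊆ comp(L), i.e., every pair of worlds related by the composition along l is related by the composition along L. (Semantic counterpart of Lemma 2: in C-S5_n, □_{i_1}…□_{i_m}φ → □_{v_1}…□_{v_λ}φ is a theorem for every word v over G = {i_1,…,i_m}.) -/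
theorem comp_refl {W I : Type*} {R : I → W → W → Prop}
    (hEq : ∀ i, Equivalence (R i)) (L : List I) (w : W) : comp R L w w := by
  induction L with
  | nil => rfl
  | cons a t ih => exact ⟨w, (hEq a).refl w, ih⟩

/-- A step along an agent of `L` can be absorbed on the left of the composition along `L`. -/
theorem comp_of_rel_of_comp {W I : Type*} {R : I → W → W → Prop}
    (hEq : ∀ i, Equivalence (R i)) (hC : CommFrame R) {L : List I} {i : I} (hi : i ∈ L)
    {w u v : W} (hwu : R i w u) (huv : comp R L u v) : comp R L w v := by
  induction L generalizing w u with
  | nil => cases hi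
  | cons a t ih =>
    obtain ⟨x, hux, hxv⟩ := huv
    rcases List.mem_cons.mp hi with rfl | hit
    · exact ⟨x, (hEq i).trans hwu hux, hxv⟩
    · obtain ⟨y, hwy, hyx⟩ := hC a i w u x hwu hux
      exact ⟨y, hwy, ih hit hyx hxv⟩

/-- Semantic counterpart of Lemma 2: any composition along a word over the agents of a
duplicate-free list `L` (with `|L| ≥ 2`) is contained in the composition along `L`. -/
theorem comp_subset_comp_nodup {W I : Type*} (R : I → W → W → Prop)
    (hEq : ∀ i, Equivalence (R i)) (hC : CommFrame R)
    (L : List I) (hnd : L.Nodup) (hm : 2 ≤ L.length)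
    (l : List I) (hl : ∀ i ∈ l, i ∈ L) :
    ∀ w v : W, comp R l w v → comp R L w v := by
  intro w v h
  induction l generalizing w with
  | nil =>
    obtain rfl : w = v := h
    exact comp_refl hEq L w
  | cons i l ih =>
    obtain ⟨u, hwu, huv⟩ := h
    exact comp_of_rel_of_comp hEq hC (hl i List.mem_cons_self) hwu
      (ih (fun j hj => hl j (List.mem_cons_of_mem i hj)) u huv)
end

section
/- Assume each R i is an equivalence relation and R satisfies the commutativity frame property, where I is a finite type with n ≥ 2 agents. Then for any two worlds w, w', if w' is reachable from w by the reflexive-transitive closure of the union of all the relations R i, then there is a path from w to w' of length at most n: there exists a list l of agents with length ≤ n such that comp(l) w w'. (Corollary 1: in a C-S5_n-model, any pair of mutually reachable worlds is connected by a path of length at most n.) -/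
/-- Under the commutativity property, a step along `i` can be absorbed into a path that
already uses `i`. -/
theorem comp_of_rel_of_mem {W I : Type*} {R : I → W → W → Prop}
    (htrans : ∀ i a b c, R i a b → R i b c → R i a c) (hC : CommFrame R) {i : I} {v : W} :
    ∀ {l : List I} {w u : W}, i ∈ l → R i w u → comp R l u v → comp R l w v
  | j :: l, w, u, hi, hwu, ⟨x, hux, hxv⟩ => by
    rcases List.mem_cons.mp hi with rfl | hi
    · exact ⟨x, htrans _ _ _ _ hwu hux, hxv⟩
    · obtain ⟨y, hwy, hyx⟩ := hC j i w u x hwu hux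
      exact ⟨y, hwy, comp_of_rel_of_mem htrans hC hi hyx hxv⟩

/-- Any reachable world is reached by a path using each agent at most once. -/
theorem exists_nodup_comp_of_reflTransGen {W I : Type*} {R : I → W → W → Prop}
    (htrans : ∀ i a b c, R i a b → R i b c → R i a c) (hC : CommFrame R) {w w' : W}
    (h : Relation.ReflTransGen (fun a b => ∃ i, R i a b) w w') :
    ∃ l : List I, l.Nodup ∧ comp R l w w' := by
  induction h using Relation.ReflTransGen.head_induction_on with
  | refl => exact ⟨[], List.nodup_nil, rfl⟩
  | head hstep _ ih =>
    obtain ⟨i, hi⟩ := hstep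
    obtain ⟨l, hl, hcomp⟩ := ih
    by_cases hmem : i ∈ l
    · exact ⟨l, hl, comp_of_rel_of_mem htrans hC hmem hi hcomp⟩
    · exact ⟨i :: l, List.nodup_cons.mpr ⟨hmem, hl⟩, _, hi, hcomp⟩

/-- Corollary 1: in a C-S5ₙ-model (with `n ≥ 2` agents), any world reachable from `w`
via the reflexive-transitive closure of the union of all the relations is reachable
by a path of length at most `n`. -/
theorem reachable_by_short_path {W I : Type*} [Fintype I]
    (hn : 2 ≤ Fintype.card I)
    (R : I → W → W → Prop) (hEq : ∀ i, Equivalence (R i)) (hC : CommFrame R) :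
    ∀ w w' : W, Relation.ReflTransGen (fun a b => ∃ i, R i a b) w w' →
      ∃ l : List I, l.length ≤ Fintype.card I ∧ comp R l w w' := by
  intro w w' h
  obtain ⟨l, hl, hcomp⟩ :=
    exists_nodup_comp_of_reflTransGen (R := R) (fun i _ _ _ => (hEq i).trans) hC h
  exact ⟨l, hl.length_le_card, hcomp⟩
end

section
/- Let b ≥ 1 and let i, j be two distinct agents; assume R i and R j are equivalence relations on W and the b-commutativity frame property holds for the pair (i, j) in both orders. Then for every list l of agents all of whose entries lie in {i, j}, comp(l) ⊆ comp(alt(i,j,2b)). (Semantic counterpart of the appendix lemma for C^b-S5_2: (□_i□_j)^b φ → □_{v_1}…□_{v_λ}φ is a theorem for every word v over {i,j}.) -/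
/-- `alt i j k` is the alternating list `[i, j, i, j, …]` of length `k`. -/
def alt {I : Type*} (i j : I) : ℕ → List I
  | 0 => []
  | k + 1 => i :: alt j i k

theorem comp_alt_refl {W I : Type*} (R : I → W → W → Prop) (i j : I)
    (hi : ∀ w, R i w w) (hj : ∀ w, R j w w) (k : ℕ) (w : W) : comp R (alt i j k) w w := by
  induction k generalizing i j with
  | zero => rfl
  | succ k ih => exact ⟨w, hi w, ih j i hj hi⟩

theorem comp_alt_of_rel_of_comp_alt {W I : Type*} (R : I → W → W → Prop) (i j : I)
    (hi : ∀ {x y z}, R i x y → R i y z → R i x z) {k : ℕ} (hk : 1 ≤ k) {w u v : W}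
    (hwu : R i w u) (huv : comp R (alt i j k) u v) : comp R (alt i j k) w v := by
  obtain ⟨k, rfl⟩ := Nat.exists_eq_add_of_le' hk
  obtain ⟨x, hux, hxv⟩ := huv
  exact ⟨x, hi hwu hux, hxv⟩

/-- Semantic counterpart of the appendix lemma for C^b-S5₂: under the b-commutativity
frame property (in both orders), any composition along a word over `{i, j}` is
contained in the composition along the alternating list of length `2b`. -/
theorem comp_subset_alt {W I : Type*} (R : I → W → W → Prop) (i j : I) (hij : i ≠ j)
    (hEi : Equivalence (R i)) (hEj : Equivalence (R j))
    (b : ℕ) (hb : 1 ≤ b)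
    (hC₁ : ∀ w v : W, comp R (alt j i (2 * b)) w v → comp R (alt i j (2 * b)) w v)
    (hC₂ : ∀ w v : W, comp R (alt i j (2 * b)) w v → comp R (alt j i (2 * b)) w v)
    (l : List I) (hl : ∀ a ∈ l, a = i ∨ a = j) :
    ∀ w v : W, comp R l w v → comp R (alt i j (2 * b)) w v := by
  intro w v
  induction l generalizing w with
  | nil =>
    rintro rfl
    exact comp_alt_refl R i j hEi.refl hEj.refl _ w
  | cons a l ih =>
    rintro ⟨u, hwu, huv⟩
    have h := ih (fun c hc => hl c (List.mem_cons_of_mem a hc)) u huv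
    have hk : 1 ≤ 2 * b := by omega
    rcases hl a List.mem_cons_self with rfl | rfl
    · exact comp_alt_of_rel_of_comp_alt R a j hEi.trans hk hwu h
    · exact hC₁ w v (comp_alt_of_rel_of_comp_alt R a i hEj.trans hk hwu (hC₂ u v h))
end

section
/- Let ℓ > 1 and assume each R i is an equivalence relation and R satisfies the weak commutativity frame property of degree ℓ. Let G ⊆ I with |G| ≥ ℓ, let v be a list of agents with all entries in G, length ≥ ℓ, in which every element of G occurs at least once, and let ρ and τ be two lists that are permutations of v. Then comp(ρ) = comp(τ). (Semantic counterpart of the appendix lemma for wC_ℓ-S5_n: □_{ρ_1}…□_{ρ_λ}φ ↔ □_{τ_1}…□_{τ_λ}φ is a theorem.) -/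
/-- The weak commutativity frame property of degree `ℓ`: for every duplicate-free list
of `ℓ` agents and every permutation of it, the composition along the permutation is
contained in the composition along the list. -/
def WeakCommFrame {W I : Type*} (R : I → W → W → Prop) (ℓ : ℕ) : Prop :=
  ∀ L π : List I, L.Nodup → L.length = ℓ → π.Perm L →
    ∀ w v : W, comp R π w v → comp R L w v

theorem comp_append {W I : Type*} (R : I → W → W → Prop) (L M : List I) (w v : W) :
    comp R (L ++ M) w v ↔ ∃ u, comp R L w u ∧ comp R M u v := by
  induction L generalizing w with
  | nil => simp [comp]
  | cons i L ih =>
    simp only [List.cons_append, comp, ih]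
    grind

theorem comp_self {W I : Type*} {R : I → W → W → Prop} (hR : ∀ i w, R i w w)
    (L : List I) (w : W) : comp R L w w := by
  induction L with
  | nil => rfl
  | cons i L ih => exact ⟨w, hR i w, ih⟩

theorem List.Sublist.comp_le {W I : Type*} {R : I → W → W → Prop} (hR : ∀ i w, R i w w)
    {L M : List I} (h : L.Sublist M) {w v : W} (hc : comp R L w v) : comp R M w v := by
  induction h generalizing w with
  | slnil => exact hc
  | cons i _ ih => exact ⟨w, hR i w, ih hc⟩
  | cons_cons i _ ih =>
    obtain ⟨u, hu, hc⟩ := hc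
    exact ⟨u, hu, ih hc⟩

namespace WeakCommFrame

theorem succ {W I : Type*} {R : I → W → W → Prop} {n : ℕ} (hn : 1 < n)
    (h : WeakCommFrame R n) : WeakCommFrame R (n + 1) := by
  classical
  intro L π hL hlen hp w v hc
  obtain _ | ⟨x, L⟩ := L
  · simp at hlen
  obtain _ | ⟨y, π⟩ := π
  · simpa using hp.length_eq
  have hlen' : L.length = n := by simpa using hlen
  have hL' := (List.nodup_cons.1 hL).2
  by_cases hxy : x = y
  · subst hxy
    obtain ⟨u, hu, hc⟩ := hc
    exact ⟨u, hu, h L π hL' hlen' hp.cons_inv _ _ hc⟩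
  have hpi : (y :: π).Nodup := hp.nodup_iff.2 hL
  have hpi' := (List.nodup_cons.1 hpi).2
  have hpilen : π.length = n := by
    have := hp.length_eq
    simp at this
    omega
  have hx : x ∈ π := by
    have : x ∈ y :: π := hp.mem_iff.2 (by simp)
    grind
  have hM := List.perm_cons_erase hx
  generalize π.erase x = M at hM
  have hc₁ : comp R (y :: x :: M) w v := by
    obtain ⟨u, hu, hc⟩ := hc
    exact ⟨u, hu, h _ _ (hM.nodup_iff.1 hpi') (hM.length_eq ▸ hpilen) hM _ _ hc⟩
  have hMlen : M.length + 1 = n := by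
    have := hM.length_eq
    simp at this
    omega
  have hpM : (x :: y :: M).Perm (x :: L) :=
    (List.Perm.swap y x M).trans ((hM.symm.cons y).trans hp)
  have hnd : (x :: y :: M).Nodup := hpM.nodup_iff.2 hL
  have hc₂ : comp R (x :: y :: M) w v := by
    rcases List.eq_nil_or_concat M with rfl | ⟨N, z, rfl⟩
    · simp at hMlen
      omega
    · have e : ∀ a b : I, a :: b :: (N ++ [z]) = (a :: b :: N) ++ [z] := fun _ _ => rfl
      simp only [List.concat_eq_append, e] at hc₁ hnd ⊢
      rw [comp_append] at hc₁ ⊢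
      obtain ⟨u, hu, hz⟩ := hc₁
      refine ⟨u, h _ _ (List.nodup_append.1 hnd).1 ?_ (List.Perm.swap x y N) _ _ hu, hz⟩
      simpa using hMlen
  obtain ⟨u, hu, hc⟩ := hc₂
  exact ⟨u, hu, h _ _ hL' hlen' hpM.cons_inv _ _ hc⟩

theorem mono {W I : Type*} {R : I → W → W → Prop} {m n : ℕ} (hm : 1 < m) (hmn : m ≤ n)
    (h : WeakCommFrame R m) : WeakCommFrame R n := by
  induction n, hmn using Nat.le_induction with
  | base => exact h
  | succ n hmn ih => exact ih.succ (by omega)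

theorem comp_append_le {W I : Type*} {R : I → W → W → Prop}
    (hR : ∀ i, Equivalence (R i)) {L : List I} (h : WeakCommFrame R L.length)
    (hL : L.Nodup) {M : List I} (hM : ∀ i ∈ M, i ∈ L) {w v : W}
    (hc : comp R (M ++ L) w v) : comp R L w v := by
  classical
  induction M generalizing w with
  | nil => exact hc
  | cons x M ih =>
    obtain ⟨u, hu, hc⟩ := hc
    have hp := List.perm_cons_erase (hM x (by simp))
    obtain ⟨t, ht, hc⟩ := h _ _ (hp.nodup_iff.1 hL) hp.length_eq.symm hp _ _
      (ih (fun i hi => hM i (by simp [hi])) hc)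
    exact h _ _ hL rfl hp.symm _ _ ⟨t, (hR x).trans hu ht, hc⟩

theorem comp_dedup {W I : Type*} [DecidableEq I] {R : I → W → W → Prop}
    (hR : ∀ i, Equivalence (R i)) {L : List I} (h : WeakCommFrame R L.dedup.length)
    (w v : W) : comp R L.dedup w v ↔ comp R L w v := by
  have hrefl : ∀ i w, R i w w := fun i => (hR i).refl
  refine ⟨(List.dedup_sublist L).comp_le hrefl, fun hc => ?_⟩
  refine h.comp_append_le hR (List.nodup_dedup L) (M := L) (by simp) ?_
  exact (comp_append R _ _ _ _).2 ⟨v, hc, comp_self hrefl _ v⟩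

end WeakCommFrame

/-- Semantic counterpart of the appendix lemma for wC_ℓ-S5ₙ: permutations of a word
over `G` that uses every agent of `G` yield the same relational composition. -/
theorem comp_perm_eq_weak {W I : Type*} (R : I → W → W → Prop)
    (hEq : ∀ i, Equivalence (R i))
    (ℓ : ℕ) (hℓ : 1 < ℓ) (hC : WeakCommFrame R ℓ)
    (G : Set I) (hG : ℓ ≤ G.ncard)
    (v : List I) (hv : ∀ i ∈ v, i ∈ G) (hlen : ℓ ≤ v.length)
    (hall : ∀ i ∈ G, i ∈ v)
    (ρ τ : List I) (hρ : ρ.Perm v) (hτ : τ.Perm v) :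
    comp R ρ = comp R τ := by
  classical
  have hGv : G = (v.toFinset : Set I) := by
    ext i
    simpa using ⟨hall i, hv i⟩
  have hvlen : ℓ ≤ v.dedup.length := by
    rwa [hGv, Set.ncard_coe_finset, List.card_toFinset] at hG
  have h := hC.mono hℓ hvlen
  have hdρ := hρ.dedup
  have hdτ := hτ.dedup
  funext w u
  apply propext
  rw [← WeakCommFrame.comp_dedup (L := ρ) hEq (hdρ.length_eq ▸ h),
    ← WeakCommFrame.comp_dedup (L := τ) hEq (hdτ.length_eq ▸ h)]
  have hp := hdρ.trans hdτ.symm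
  exact ⟨h _ _ (List.nodup_dedup τ) hdτ.length_eq hp w u,
    h _ _ (List.nodup_dedup ρ) hdρ.length_eq hp.symm w u⟩
end

section
/- Let I be a type of agents and P ⊆ I a set (the partially observant agents). Define the relation family Q : I → Fin 2 → Fin 2 → Prop by Q i x y ↔ (x = y ∨ i ∈ P). Then each Q i is an equivalence relation on Fin 2 and Q satisfies the commutativity frame property: for all agents i, j and all x, y, z in Fin 2, if Q j x y and Q i y z then there exists u with Q i x u and Q j u z. (This is the key step of Lemma 5: the frames of semi-private sensing/announcement actions of the S5_n-fragment of mA* are C-S5_n-frames.) -/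
/-- Lemma 5 (key step, mA*): the two-event frame of a semi-private sensing/announcement
action of the S5ₙ-fragment of mA*, with partially observant agents `P`, consists of
equivalence relations and satisfies the commutativity frame property. -/
theorem mAStar_sensing_frame_comm {I : Type*} (P : Set I)
    (Q : I → Fin 2 → Fin 2 → Prop) (hQ : ∀ i x y, Q i x y ↔ (x = y ∨ i ∈ P)) :
    (∀ i, Equivalence (Q i)) ∧
    (∀ (i j : I) (x y z : Fin 2), Q j x y → Q i y z → ∃ u, Q i x u ∧ Q j u z) := by
  simp only [hQ]
  refine ⟨fun i => ⟨fun x => ?_, fun h => ?_, fun h h' => ?_⟩, fun i j x y z hxy hyz => ?_⟩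
  · exact (hQ i x x).2 (Or.inl rfl)
  · exact (hQ i _ _).2 (((hQ i _ _).1 h).imp_left Eq.symm)
  · rw [hQ] at h h' ⊢
    grind
  · rcases hyz with rfl | hi
    · exact ⟨x, Or.inl rfl, hxy⟩
    · exact ⟨z, Or.inr hi, Or.inl rfl⟩
end
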